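/- arXiv:2107.08014 — 5 statements merged into one kernel-verified Lean document; each statement's English description precedes it below -/
import Mathlib

section
/- Proportional uniform pricing for downward re-dispatch: Fix a scenario k with probability ε_k > 0 and two generators i, j located at the same bus, so that ω_k(m_i) = ω_k(m_j) = ω_k. Suppose that for each generator h ∈ {i, j}, with downward re-dispatch δg^D_k(h) > 0, procured downward reserve r_D(h), downward re-dispatch price c̲(h), and nonnegative multipliers β̲_k(h), β̄_k(h), the KKT conditions hold: −ε_k·c̲(h) − β̲_k(h) + β̄_k(h) + ω_k = 0, β̲_k(h)·δg^D_k(h) = 0, and β̄_k(h)·(δg^D_k(h) − r_D(h)) = 0. Then, with Π^D_k(h) = β̄_k(h)·r_D(h) − ε_k·c̲(h)·δg^D_k(h) denoting the scenario-k contribution to the downward reserve credit plus expected downward re-dispatch pay-back, one has Π^D_k(i)/δg^D_k(i) = Π^D_k(j)/δg^D_k(j) = −ω_k. -/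
/-- The KKT conditions of a single generator with bid price `c` and nonzero downward
re-dispatch `δ` make its average downward payment equal to `-ω`. -/
theorem downward_payment_div_redispatch {ε ω δ r c βlow βbar : ℝ} (hδ : δ ≠ 0)
    (hstat : -(ε * c) - βlow + βbar + ω = 0)
    (hlow : βlow * δ = 0) (hup : βbar * (δ - r) = 0) :
    (βbar * r - ε * c * δ) / δ = -ω := by
  rw [div_eq_iff hδ]
  linear_combination δ * hstat + hlow - hup

/-- Proportional uniform pricing for downward re-dispatch: for two generators
`i, j` at the same bus (scenario-`k` price components coincide and equal `ωk`),
if both satisfy the KKT conditions for downward re-dispatch and have strictly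
positive downward re-dispatch, then with
`Π^D_k(h) = β̄_k(h)·r_D(h) − ε_k·c̲(h)·δg^D_k(h)` one has
`Π^D_k(i)/δg^D_k(i) = Π^D_k(j)/δg^D_k(j) = −ωk`. -/
theorem proportional_uniform_pricing_downward_redispatch
    (εk ωk : ℝ) (hε : 0 < εk)
    (δgDi δgDj rDi rDj clowi clowj : ℝ)
    (βlowi βbari βlowj βbarj : ℝ)
    (hδi : 0 < δgDi) (hδj : 0 < δgDj)
    (hβlowi : 0 ≤ βlowi) (hβbari : 0 ≤ βbari)
    (hβlowj : 0 ≤ βlowj) (hβbarj : 0 ≤ βbarj)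
    (hstati : -(εk * clowi) - βlowi + βbari + ωk = 0)
    (hstatj : -(εk * clowj) - βlowj + βbarj + ωk = 0)
    (hcsi_low : βlowi * δgDi = 0) (hcsi_up : βbari * (δgDi - rDi) = 0)
    (hcsj_low : βlowj * δgDj = 0) (hcsj_up : βbarj * (δgDj - rDj) = 0)
    (PiDi PiDj : ℝ)
    (hPii : PiDi = βbari * rDi - εk * clowi * δgDi)
    (hPij : PiDj = βbarj * rDj - εk * clowj * δgDj) :
    PiDi / δgDi = -ωk ∧ PiDj / δgDj = -ωk := by
  subst hPii hPij
  exact ⟨downward_payment_div_redispatch hδi.ne' hstati hcsi_low hcsi_up,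
    downward_payment_div_redispatch hδj.ne' hstatj hcsj_low hcsj_up⟩
end

section
/- Theorem 3 (Individual rationality): Fix a generator j with bid-in prices c_g, c_U, c_D for energy, upward reserve, and downward reserve, capacity bounds 0 ≤ g + r_U ≤ Ḡ, r_D ≤ g (lower generation bound G̲ = 0), 0 ≤ r_U ≤ r̄_U, 0 ≤ r_D ≤ r̄_D, and settlement prices η^g, η^U, η^D. Suppose there exist nonnegative Lagrange multipliers ῡ, υ̲, ρ̲^U, ρ̄^U, ρ̲^D, ρ̄^D and a point (g*, r*_U, r*_D) feasible for these bounds, satisfying the stationarity conditions c_g − η^g + ῡ − υ̲ = 0, c_U − η^U + ῡ − ρ̲^U + ρ̄^U = 0, c_D − η^D + υ̲ − ρ̲^D + ρ̄^D = 0, and the complementary slackness conditions ῡ·(g* + r*_U − Ḡ) = 0, υ̲·(r*_D − g*) = 0, ρ̲^U·r*_U = 0, ρ̄^U·(r*_U − r̄_U) = 0, ρ̲^D·r*_D = 0, ρ̄^D·(r*_D − r̄_D) = 0. Then for every (g, r_U, r_D) satisfying 0 ≤ r_U ≤ r̄_U, 0 ≤ r_D ≤ r̄_D, r_D ≤ g,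 and g + r_U ≤ Ḡ, the profit (η^g − c_g)·g + (η^U − c_U)·r_U + (η^D − c_D)·r_D is at most (η^g − c_g)·g* + (η^U − c_U)·r*_U + (η^D − c_D)·r*_D; that is, (g*, r*_U, r*_D) maximizes the generator's profit at the given prices subject to its private constraints. -/
/-- Theorem 3 (Individual Rationality): if `(g*, r*_U, r*_D)` is feasible for
the generator's private constraints (with lower generation bound `G̲ = 0`) and
there exist nonnegative multipliers satisfying the KKT stationarity and
complementary slackness conditions at the settlement prices `η^g, η^U, η^D`,
then `(g*, r*_U, r*_D)` maximizes the generator's profit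
`(η^g − c_g)·g + (η^U − c_U)·r_U + (η^D − c_D)·r_D` over all
`(g, r_U, r_D)` satisfying `0 ≤ r_U ≤ r̄_U`, `0 ≤ r_D ≤ r̄_D`, `r_D ≤ g`,
`g + r_U ≤ Ḡ`. -/
theorem individual_rationality
    (cg cU cD ηg ηU ηD Gbar rUbar rDbar : ℝ)
    (υbar υlow ρUlow ρUbar ρDlow ρDbar : ℝ)
    (gs rUs rDs : ℝ)
    (hυbar : 0 ≤ υbar) (hυlow : 0 ≤ υlow)
    (hρUlow : 0 ≤ ρUlow) (hρUbar : 0 ≤ ρUbar)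
    (hρDlow : 0 ≤ ρDlow) (hρDbar : 0 ≤ ρDbar)
    (hfeas_rU : 0 ≤ rUs ∧ rUs ≤ rUbar)
    (hfeas_rD : 0 ≤ rDs ∧ rDs ≤ rDbar)
    (hfeas_g_low : rDs ≤ gs)
    (hfeas_g_up : gs + rUs ≤ Gbar)
    (hstat_g : cg - ηg + υbar - υlow = 0)
    (hstat_rU : cU - ηU + υbar - ρUlow + ρUbar = 0)
    (hstat_rD : cD - ηD + υlow - ρDlow + ρDbar = 0)
    (hcs_up : υbar * (gs + rUs - Gbar) = 0)
    (hcs_low : υlow * (rDs - gs) = 0)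
    (hcs_rU_low : ρUlow * rUs = 0)
    (hcs_rU_up : ρUbar * (rUs - rUbar) = 0)
    (hcs_rD_low : ρDlow * rDs = 0)
    (hcs_rD_up : ρDbar * (rDs - rDbar) = 0) :
    ∀ g rU rD : ℝ,
      0 ≤ rU → rU ≤ rUbar → 0 ≤ rD → rD ≤ rDbar → rD ≤ g → g + rU ≤ Gbar →
      (ηg - cg) * g + (ηU - cU) * rU + (ηD - cD) * rD
        ≤ (ηg - cg) * gs + (ηU - cU) * rUs + (ηD - cD) * rDs := by
  intro g rU rD hrU0 hrU hrD0 hrD hlow hup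
  have hg : ηg - cg = υbar - υlow := by linarith
  have hU : ηU - cU = υbar - ρUlow + ρUbar := by linarith
  have hD : ηD - cD = υlow - ρDlow + ρDbar := by linarith
  rw [hg, hU, hD]
  linarith [mul_nonneg hυbar (sub_nonneg.2 hup), mul_nonneg hυlow (sub_nonneg.2 hlow),
    mul_nonneg hρUlow hrU0, mul_nonneg hρUbar (sub_nonneg.2 hrU),
    mul_nonneg hρDlow hrD0, mul_nonneg hρDbar (sub_nonneg.2 hrD)]
end

section
/- Corollary 1 (Cost recovery): Under the hypotheses of Theorem 3 — namely, a feasible point (g*, r*_U, r*_D) of the generator's constraint set with G̲ = 0, nonnegative multipliers ῡ, υ̲, ρ̲^U, ρ̄^U, ρ̲^D, ρ̄^D satisfying the stationarity conditions c_g − η^g + ῡ − υ̲ = 0, c_U − η^U + ῡ − ρ̲^U + ρ̄^U = 0, c_D − η^D + υ̲ − ρ̲^D + ρ̄^D = 0 and the complementary slackness conditions ῡ·(g* + r*_U − Ḡ) = 0, υ̲·(r*_D − g*) = 0, ρ̲^U·r*_U = 0, ρ̄^U·(r*_U − r̄_U) = 0, ρ̲^D·r*_D = 0, ρ̄^D·(r*_D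 − r̄_D) = 0, and assuming Ḡ ≥ 0, r̄_U ≥ 0, r̄_D ≥ 0 — the generator's total ex-ante credit is no less than its total bid-in cost: η^g·g* + η^U·r*_U + η^D·r*_D ≥ c_g·g* + c_U·r*_U + c_D·r*_D. -/
/-- Corollary 1 (Cost Recovery): under the hypotheses of Theorem 3 (individual
rationality), and assuming `Ḡ ≥ 0`, `r̄_U ≥ 0`, `r̄_D ≥ 0`, the generator's
total ex-ante credit is no less than its total bid-in cost:
`η^g·g* + η^U·r*_U + η^D·r*_D ≥ c_g·g* + c_U·r*_U + c_D·r*_D`. -/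
theorem cost_recovery
    (cg cU cD ηg ηU ηD Gbar rUbar rDbar : ℝ)
    (υbar υlow ρUlow ρUbar ρDlow ρDbar : ℝ)
    (gs rUs rDs : ℝ)
    (hGbar : 0 ≤ Gbar) (hrUbar : 0 ≤ rUbar) (hrDbar : 0 ≤ rDbar)
    (hυbar : 0 ≤ υbar) (hυlow : 0 ≤ υlow)
    (hρUlow : 0 ≤ ρUlow) (hρUbar : 0 ≤ ρUbar)
    (hρDlow : 0 ≤ ρDlow) (hρDbar : 0 ≤ ρDbar)
    (hfeas_rU : 0 ≤ rUs ∧ rUs ≤ rUbar)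
    (hfeas_rD : 0 ≤ rDs ∧ rDs ≤ rDbar)
    (hfeas_g_low : rDs ≤ gs)
    (hfeas_g_up : gs + rUs ≤ Gbar)
    (hstat_g : cg - ηg + υbar - υlow = 0)
    (hstat_rU : cU - ηU + υbar - ρUlow + ρUbar = 0)
    (hstat_rD : cD - ηD + υlow - ρDlow + ρDbar = 0)
    (hcs_up : υbar * (gs + rUs - Gbar) = 0)
    (hcs_low : υlow * (rDs - gs) = 0)
    (hcs_rU_low : ρUlow * rUs = 0)
    (hcs_rU_up : ρUbar * (rUs - rUbar) = 0)
    (hcs_rD_low : ρDlow * rDs = 0)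
    (hcs_rD_up : ρDbar * (rDs - rDbar) = 0) :
    ηg * gs + ηU * rUs + ηD * rDs ≥ cg * gs + cU * rUs + cD * rDs := by
  have profit_eq : ηg * gs + ηU * rUs + ηD * rDs - (cg * gs + cU * rUs + cD * rDs)
      = υbar * Gbar + ρUbar * rUbar + ρDbar * rDbar := by
    linear_combination -gs * hstat_g - rUs * hstat_rU - rDs * hstat_rD + hcs_up + hcs_low
      - hcs_rU_low + hcs_rU_up - hcs_rD_low + hcs_rD_up
  have profit_nonneg : 0 ≤ υbar * Gbar + ρUbar * rUbar + ρDbar * rDbar := by positivity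
  linarith
end

section
/- Base-case revenue adequacy (equations (30)/(70)): Let g ∈ ℝ^{NG} be generator outputs, d ∈ ℝ^{ND} loads, θ ∈ ℝ^{NB} phase angles, Λ ∈ ℝ^{NB} the multipliers of the nodal balance constraints, μ ∈ ℝ^{NL} the multipliers of the transmission constraints, A_G ∈ ℝ^{NB×NG} and A_D ∈ ℝ^{NB×ND} the generator- and load-to-node incidence matrices, B ∈ ℝ^{NB×NB} the DC power-flow matrix, F ∈ ℝ^{NL×NB} the branch-node admittance matrix, f ∈ ℝ^{NL} the line capacities, λ ∈ ℝ, and S_G, S_D the shift-factor matrices. Assume: (a) nodal balance A_G·g − A_D·d = B·θ; (b) stationarity in θ: Bᵀ·Λ + Fᵀ·μ = 0; (c) complementary slackness μᵀ·(F·θ − f) = 0; (d) the multiplier relations A_DᵀΛ = λ·𝟙_{ND} − S_Dᵀμ and A_GᵀΛ = λ·𝟙_{NG} − S_Gᵀμ. Then the base-case load energy payment equals the base-case generator energy credit plus the base-case congestion rent: (λ·𝟙_{ND} − S_Dᵀμ)ᵀ·d − (λ·𝟙_{NG} − S_Gᵀμ)ᵀ·g = fᵀ·μ. -/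
open Matrix

/-- Base-case revenue adequacy (equations (30)/(70)): the base-case load energy
payment equals the base-case generator energy credit plus the base-case
congestion rent `fᵀμ`. -/
theorem base_case_revenue_adequacy
    {NG ND NB NL : Type*} [Fintype NG] [Fintype ND] [Fintype NB] [Fintype NL]
    (g : NG → ℝ) (d : ND → ℝ) (θ : NB → ℝ)
    (Λ : NB → ℝ) (μ : NL → ℝ)
    (AG : Matrix NB NG ℝ) (AD : Matrix NB ND ℝ)
    (B : Matrix NB NB ℝ) (F : Matrix NL NB ℝ)
    (f : NL → ℝ) (lam : ℝ)
    (SG : Matrix NL NG ℝ) (SD : Matrix NL ND ℝ)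
    (hbal : AG *ᵥ g - AD *ᵥ d = B *ᵥ θ)
    (hstat : Bᵀ *ᵥ Λ + Fᵀ *ᵥ μ = 0)
    (hcs : μ ⬝ᵥ (F *ᵥ θ - f) = 0)
    (hD : ADᵀ *ᵥ Λ = (fun _ => lam) - SDᵀ *ᵥ μ)
    (hG : AGᵀ *ᵥ Λ = (fun _ => lam) - SGᵀ *ᵥ μ) :
    ((fun _ => lam) - SDᵀ *ᵥ μ) ⬝ᵥ d - ((fun _ => lam) - SGᵀ *ᵥ μ) ⬝ᵥ g
      = f ⬝ᵥ μ := by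
  have hθ : Λ ⬝ᵥ (B *ᵥ θ) + μ ⬝ᵥ (F *ᵥ θ) = 0 := by
    rw [dotProduct_mulVec, dotProduct_mulVec, ← add_dotProduct, ← mulVec_transpose,
      ← mulVec_transpose, hstat, zero_dotProduct]
  rw [← hbal, dotProduct_sub] at hθ
  rw [dotProduct_sub] at hcs
  rw [← hD, ← hG, mulVec_transpose, mulVec_transpose, ← dotProduct_mulVec,
    ← dotProduct_mulVec, dotProduct_comm f μ]
  linarith
end

section
/- Theorem 4, scenario-wise revenue adequacy (equations (33)/(77)): Fix a non-base scenario k with probability ε_k > 0. Let the quantities g(j), r_U(j), r_D(j), δg^U_k(j), δg^D_k(j) for generators j and d(l), π_k(l), δd_k(l) for loads l, with bus price components ω_k(m_j) = λ_k − S_{G,k}(·,m_j)ᵀμ_k and ω_k(m_l) = λ_k − S_{D,k}(·,m_l)ᵀμ_k and nonnegative multipliers α̲_k, ᾱ_k, β̲_k, β̄_k, τ̲_k, satisfy: (a) scenario power balance Σ_j (g(j) + δg^U_k(j) − δg^D_k(j)) = Σ_l (d(l) + π_k(l) − δd_k(l)); (b) for each generator j, the stationarity conditions ε_k·c̄(j)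 − α̲_k(j) + ᾱ_k(j) − ω_k(m_j) = 0 and −ε_k·c̲(j) − β̲_k(j) + β̄_k(j) + ω_k(m_j) = 0 and complementary slackness α̲_k(j)·δg^U_k(j) = 0, ᾱ_k(j)·(δg^U_k(j) − r_U(j)) = 0, β̲_k(j)·δg^D_k(j) = 0, β̄_k(j)·(δg^D_k(j) − r_D(j)) = 0; (c) for each load l, the stationarity condition ε_k·c_L(l) − τ̲_k(l) − ω_k(m_l) = 0 (upper-bound multiplier τ̄_k(l) = 0) and complementary slackness τ̲_k(l)·δd_k(l) = 0; (d) the congestion rent identity Δ_k = Σ_l S_{D,k}(·,m_l)ᵀμ_k·(δd_k(l) − d(l) − π_k(l)) + Σ_j S_{G,k}(·,m_j)ᵀμ_k·(g(j) + δg^U_k(j) − δg^D_k(j)). Then Σ_l ω_k(m_l)·(d(l) + π_k(l)) = Σ_j ω_k(m_j)·g(j) + Σ_j ᾱ_k(j)·r_U(j) + Σ_j β̄_k(j)·r_D(j) + ε_k·(Σ_j c̄(j)·δg^U_k(j) − Σ_j c̲(j)·δg^D_k(j) + Σ_l c_L(l)·δd_k(l)) + Δ_k; that is, scenario k's contribution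 to load energy and fluctuation payments equals the sum of its contributions to generator energy credit, upward and downward reserve credits, expected re-dispatch payments, expected load-shedding compensation, and congestion rent. -/
open Finset

/-- Theorem 4, scenario-wise revenue adequacy (equations (33)/(77)): scenario
`k`'s contribution to load energy and fluctuation payments equals the sum of
its contributions to generator energy credit, upward and downward reserve
credits, expected re-dispatch payments, expected load-shedding compensation,
and congestion rent. -/
theorem scenario_wise_revenue_adequacy
    {Gen Load L : Type*} [Fintype Gen] [Fintype Load] [Fintype L]
    (εk : ℝ) (hε : 0 < εk)
    (g rU rD δgU δgD : Gen → ℝ) (d πk δd : Load → ℝ)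
    (lamk : ℝ) (μk : L → ℝ)
    (SGcol : Gen → L → ℝ) (SDcol : Load → L → ℝ)
    (ωG : Gen → ℝ) (ωL : Load → ℝ)
    (hωG : ∀ j, ωG j = lamk - ∑ e, SGcol j e * μk e)
    (hωL : ∀ l, ωL l = lamk - ∑ e, SDcol l e * μk e)
    (αlow αbar βlow βbar : Gen → ℝ) (τlow : Load → ℝ)
    (cbar clow : Gen → ℝ) (cL : Load → ℝ)
    (hαlow : ∀ j, 0 ≤ αlow j) (hαbar : ∀ j, 0 ≤ αbar j)
    (hβlow : ∀ j, 0 ≤ βlow j) (hβbar : ∀ j, 0 ≤ βbar j)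
    (hτlow : ∀ l, 0 ≤ τlow l)
    (hbal : ∑ j, (g j + δgU j - δgD j) = ∑ l, (d l + πk l - δd l))
    (hstatU : ∀ j, εk * cbar j - αlow j + αbar j - ωG j = 0)
    (hstatD : ∀ j, -(εk * clow j) - βlow j + βbar j + ωG j = 0)
    (hcsαlow : ∀ j, αlow j * δgU j = 0)
    (hcsαbar : ∀ j, αbar j * (δgU j - rU j) = 0)
    (hcsβlow : ∀ j, βlow j * δgD j = 0)
    (hcsβbar : ∀ j, βbar j * (δgD j - rD j) = 0)
    (hstatL : ∀ l, εk * cL l - τlow l - ωL l = 0)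
    (hcsτ : ∀ l, τlow l * δd l = 0)
    (Δk : ℝ)
    (hΔ : Δk = ∑ l, (∑ e, SDcol l e * μk e) * (δd l - d l - πk l)
        + ∑ j, (∑ e, SGcol j e * μk e) * (g j + δgU j - δgD j)) :
    ∑ l, ωL l * (d l + πk l)
      = ∑ j, ωG j * g j + ∑ j, αbar j * rU j + ∑ j, βbar j * rD j
        + εk * (∑ j, cbar j * δgU j - ∑ j, clow j * δgD j
            + ∑ l, cL l * δd l)
        + Δk := by
  have hU : ∑ j, ωG j * δgU j = εk * ∑ j, cbar j * δgU j + ∑ j, αbar j * rU j := by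
    rw [mul_sum, ← sum_add_distrib]
    refine sum_congr rfl fun j _ => ?_
    linear_combination (-δgU j) * hstatU j - hcsαlow j + hcsαbar j
  have hD : ∑ j, ωG j * δgD j = εk * ∑ j, clow j * δgD j - ∑ j, βbar j * rD j := by
    rw [mul_sum, ← sum_sub_distrib]
    refine sum_congr rfl fun j _ => ?_
    linear_combination δgD j * hstatD j + hcsβlow j - hcsβbar j
  have hL : ∑ l, ωL l * δd l = εk * ∑ l, cL l * δd l := by
    rw [mul_sum]
    refine sum_congr rfl fun l _ => ?_
    linear_combination (-δd l) * hstatL l - hcsτ l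
  have hload : ∑ l, (∑ e, SDcol l e * μk e) * (δd l - d l - πk l)
      = ∑ l, ωL l * (d l + πk l) - ∑ l, ωL l * δd l
        - lamk * ∑ l, (d l + πk l - δd l) := by
    rw [mul_sum, ← sum_sub_distrib, ← sum_sub_distrib]
    refine sum_congr rfl fun l _ => ?_
    rw [hωL l]
    ring
  have hgen : ∑ j, (∑ e, SGcol j e * μk e) * (g j + δgU j - δgD j)
      = lamk * ∑ j, (g j + δgU j - δgD j)
        - (∑ j, ωG j * g j + ∑ j, ωG j * δgU j - ∑ j, ωG j * δgD j) := by
    rw [mul_sum, ← sum_add_distrib, ← sum_sub_distrib, ← sum_sub_distrib]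
    refine sum_congr rfl fun j _ => ?_
    rw [hωG j]
    ring
  rw [hΔ, hload, hgen, hbal, hU, hD, hL]
  ring
end
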